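/- arXiv:2406.09632 — 2 statements merged into one kernel-verified Lean document; each statement's English description precedes it below -/
import Mathlib

section
/- Let p be a prime and a, b, c nonnegative integers with b ≥ 1 and c ≥ 1. Then in F_p[t]: c·f(a,b,c) = (a−c+1)·t·f(a,b,c−1) + b·f(a+1,b−1,c−1), where the scalar coefficients c, a−c+1, and b are the images in F_p of the corresponding integers (a−c+1 being an integer that may be negative). -/
/-- `fabc p a b c = ∑_{i+j=c} C(a,i)·C(b,j)·t^i` in `F_p[t]`. -/
noncomputable def fabc (p a b c : ℕ) : Polynomial (ZMod p) :=
  ∑ i ∈ Finset.range (c + 1),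
    Polynomial.C ((a.choose i : ZMod p) * (b.choose (c - i) : ZMod p)) * Polynomial.X ^ i

theorem coeff_fabc (p a b c n : ℕ) :
    (fabc p a b c).coeff n =
      if n ≤ c then (a.choose n : ZMod p) * (b.choose (c - n) : ZMod p) else 0 := by
  simp [fabc, Polynomial.finsetSum_coeff, Polynomial.coeff_C_mul, Polynomial.coeff_X_pow,
    -map_mul]

theorem cast_choose_succ_mul {R : Type*} [CommRing R] (a k : ℕ) :
    (a.choose (k + 1) : R) * (k + 1) = a.choose k * (a - k) := by
  have h := congrArg (Nat.cast (R := R)) (Nat.choose_succ_right_eq a k)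
  rcases le_or_gt k a with hk | hk
  · simpa [Nat.cast_sub hk] using h
  · simp [Nat.choose_eq_zero_of_lt hk, Nat.choose_eq_zero_of_lt (hk.trans k.lt_succ_self)]

theorem cast_succ_mul_choose {R : Type*} [CommRing R] (b j : ℕ) :
    ((b : R) + 1) * b.choose j = (b + 1).choose (j + 1) * (j + 1) := by
  exact_mod_cast congrArg (Nat.cast (R := R)) (Nat.add_one_mul_choose_eq b j)

/-- First recurrence from the proof of Lemma `recurrance one`: in `F_p[t]`, for `b, c ≥ 1`,
`c·f(a,b,c) = (a-c+1)·t·f(a,b,c-1) + b·f(a+1,b-1,c-1)` (the scalar `a-c+1` being the image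
in `F_p` of the integer `a-c+1`, which may be negative). -/
theorem stmt_10 (p : ℕ) (hp : p.Prime) (a b c : ℕ) (hb : 1 ≤ b) (hc : 1 ≤ c) :
    Polynomial.C ((c : ZMod p)) * fabc p a b c
      = Polynomial.C ((((a : ℤ) - (c : ℤ) + 1 : ℤ) : ZMod p)) *
          (Polynomial.X * fabc p a b (c - 1))
        + Polynomial.C ((b : ZMod p)) * fabc p (a + 1) (b - 1) (c - 1) := by
  obtain ⟨b, rfl⟩ := Nat.exists_eq_add_of_le' hb
  obtain ⟨c, rfl⟩ := Nat.exists_eq_add_of_le' hc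
  simp only [Nat.add_sub_cancel]
  ext n
  rw [Polynomial.coeff_add, Polynomial.coeff_C_mul, Polynomial.coeff_C_mul,
    Polynomial.coeff_C_mul]
  rcases n with _ | k
  · rw [Polynomial.coeff_X_mul_zero]
    simp only [coeff_fabc, Nat.zero_le, if_true, Nat.choose_zero_right, Nat.sub_zero]
    have hB := cast_succ_mul_choose (R := ZMod p) b c
    push_cast
    linear_combination -hB
  · rw [Polynomial.coeff_X_mul]
    simp only [coeff_fabc, Nat.add_le_add_iff_right, Nat.add_sub_add_right]
    have hA := cast_choose_succ_mul (R := ZMod p) a k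
    rcases lt_trichotomy k c with hk | rfl | hk
    · obtain ⟨j, rfl⟩ := Nat.exists_eq_add_of_lt hk
      have hB := cast_succ_mul_choose (R := ZMod p) b j
      have h₁ : k + j + 1 - k = j + 1 := by omega
      have h₂ : k + j + 1 - (k + 1) = j := by omega
      rw [if_pos hk.le, if_pos hk.le, if_pos (Nat.succ_le_of_lt hk), h₁, h₂,
        Nat.choose_succ_succ a k]
      push_cast
      linear_combination ((b + 1).choose (j + 1) : ZMod p) * hA -
        ((a.choose k : ZMod p) + a.choose (k + 1)) * hB
    · simp only [le_refl, if_true, Nat.not_succ_le_self, if_false, Nat.sub_self,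
        Nat.choose_zero_right]
      push_cast
      linear_combination hA
    · rw [if_neg hk.not_ge, if_neg hk.not_ge, if_neg (by omega)]
      ring
end

section
/- Let p be a prime and a₁, a₂, b₁, b₂, c₁, c₂ nonnegative integers with aᵢ ≤ p−1, bᵢ ≤ p−1, and cᵢ ≤ aᵢ+bᵢ for i = 1, 2, and assume min{a₁, b₁, c₁, a₁+b₁−c₁} ≥ 3. If f(a₁,b₁,c₁) = λ·f(a₂,b₂,c₂) for some nonzero λ ∈ F_p, then a₁+b₁ = a₂+b₂ (as integers) and, as subsets of ℤ/pℤ, {a₁ mod p, c₁ mod p, (c₂−b₂−1) mod p} = {a₂ mod p, c₂ mod p, (c₁−b₁−1) mod p}. -/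
theorem fabc_coeff (p a b c i : ℕ) :
    (fabc p a b c).coeff i =
      if i ≤ c then (a.choose i : ZMod p) * (b.choose (c - i) : ZMod p) else 0 := by
  simp only [fabc, Polynomial.finsetSum_coeff, Polynomial.coeff_C_mul_X_pow, Finset.sum_ite_eq,
    Finset.mem_range, Nat.lt_succ_iff]

theorem natCast_choose_ne_zero {p n k : ℕ} (hp : p.Prime) (hn : n < p) (hk : k ≤ n) :
    (n.choose k : ZMod p) ≠ 0 := by
  rw [Ne, ZMod.natCast_eq_zero_iff]
  intro h
  have h' : p ∣ n.factorial := by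
    rw [← Nat.choose_mul_factorial_mul_factorial hk, mul_assoc]
    exact h.mul_right _
  exact absurd ((hp.dvd_factorial).1 h') (by omega)

theorem fabc_coeff_ne_zero_iff {p a b c : ℕ} (hp : p.Prime) (ha : a < p) (hb : b < p) (i : ℕ) :
    (fabc p a b c).coeff i ≠ 0 ↔ i ≤ a ∧ i ≤ c ∧ c ≤ b + i := by
  have := Fact.mk hp
  rw [fabc_coeff]
  constructor
  · intro h
    by_cases hic : i ≤ c
    · rw [if_pos hic] at h
      refine ⟨?_, hic, ?_⟩
      · by_contra hia
        exact h (by rw [Nat.choose_eq_zero_of_lt (by omega : a < i)]; simp)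
      · by_contra hib
        exact h (by rw [Nat.choose_eq_zero_of_lt (by omega : b < c - i)]; simp)
    · simp [hic] at h
  · rintro ⟨h₁, h₂, h₃⟩
    rw [if_pos h₂]
    exact mul_ne_zero (natCast_choose_ne_zero hp ha h₁)
      (natCast_choose_ne_zero hp hb (by omega))

/-- The hypergeometric recursion between consecutive coefficients of `fabc p a b c`. -/
theorem fabc_coeff_succ (p : ℕ) {a b c i : ℕ} (hia : i ≤ a) (hic : i + 1 ≤ c)
    (hib : c ≤ b + (i + 1)) :
    (fabc p a b c).coeff (i + 1) * ((i + 1 : ZMod p) * (i + 1 + b - c)) =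
      (fabc p a b c).coeff i * ((a - i) * (c - i)) := by
  rw [fabc_coeff, fabc_coeff, if_pos hic, if_pos (by omega)]
  obtain ⟨k, rfl⟩ := Nat.exists_eq_add_of_le hic
  obtain ⟨m, rfl⟩ := Nat.exists_eq_add_of_le hia
  obtain ⟨n, rfl⟩ := Nat.exists_eq_add_of_le (by omega : k ≤ b)
  have h₁ := Nat.choose_succ_right_eq (i + m) i
  have h₂ := Nat.choose_succ_right_eq (k + n) k
  rw [Nat.add_sub_cancel_left] at h₁ h₂
  rw [show i + 1 + k - (i + 1) = k by omega, show i + 1 + k - i = k + 1 by omega]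
  replace h₁ := congrArg (Nat.cast : ℕ → ZMod p) h₁
  replace h₂ := congrArg (Nat.cast : ℕ → ZMod p) h₂
  push_cast at h₁ h₂ ⊢
  linear_combination
    (((k + n).choose k : ZMod p) * n) * h₁ - (((i + m).choose i : ZMod p) * m) * h₂

/-- Two monic cubics that agree at three consecutive points have the same coefficients. -/
theorem monic_cubic_eq_of_consecutive {K : Type*} [Field K] (h2 : (2 : K) ≠ 0)
    {r s t u v w x : K}
    (h : ∀ j : ℕ, j < 3 →
      (x + j - r) * (x + j - s) * (x + j - t) = (x + j - u) * (x + j - v) * (x + j - w)) :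
    r + s + t = u + v + w ∧
      ∀ y, (y - r) * (y - s) * (y - t) = (y - u) * (y - v) * (y - w) := by
  have h₀ := h 0 (by norm_num)
  have h₁ := h 1 (by norm_num)
  have h₂ := h 2 (by norm_num)
  push_cast at h₀ h₁ h₂
  have hsum : r + s + t = u + v + w := by
    apply mul_left_cancel₀ h2
    linear_combination 2 * h₁ - h₀ - h₂
  have hlin : r * s + s * t + r * t = u * v + v * w + u * w := by
    linear_combination h₁ - h₀ + (2 * x + 1) * hsum
  refine ⟨hsum, fun y => ?_⟩
  linear_combination h₀ - (y ^ 2 - x ^ 2) * hsum + (y - x) * hlin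

theorem natCast_inj_of_lt {p m n : ℕ} (hm : m < p) (hn : n < p)
    (h : (m : ZMod p) = n) : m = n :=
  Nat.ModEq.eq_of_lt_of_lt ((ZMod.natCast_eq_natCast_iff _ _ _).1 h) hm hn

theorem add_ne_add_add_prime {p a₁ a₂ b₁ b₂ c₁ c₂ : ℕ} (hp : p.Prime)
    (ha₁ : a₁ < p) (hb₁ : b₁ < p) (hc₁ : c₁ ≤ a₁ + b₁) (hc₂ : c₂ ≤ a₂ + b₂)
    (hsupp : ∀ i, i ≤ a₁ ∧ i ≤ c₁ ∧ c₁ ≤ b₁ + i → i ≤ a₂ ∧ i ≤ c₂ ∧ c₂ ≤ b₂ + i)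
    (hroot : ((a₁ : ZMod p) - a₂) * (a₁ - c₂) * (a₁ - (c₁ - b₁ - 1)) = 0) :
    a₁ + b₁ ≠ a₂ + b₂ + p := by
  have := Fact.mk hp
  intro h
  have hmin := hsupp (min a₁ c₁) (by omega)
  have hcast := congrArg (Nat.cast : ℕ → ZMod p) h
  push_cast at hcast
  rw [ZMod.natCast_self, add_zero] at hcast
  rcases mul_eq_zero.1 hroot with h' | h'
  · rcases mul_eq_zero.1 h' with h' | h'
    · have := natCast_inj_of_lt (by omega) (by omega) (sub_eq_zero.1 h')
      omega
    · have := natCast_inj_of_lt (by omega) (by omega) (sub_eq_zero.1 h')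
      omega
  · have : ((a₂ + b₂ + 1 : ℕ) : ZMod p) = c₁ := by
      push_cast
      linear_combination h' - hcast
    have := natCast_inj_of_lt (by omega) (by omega) this
    omega

/-- Part (1) of Lemma `f(abc) constant multiple`: with `aᵢ, bᵢ ≤ p-1`, `cᵢ ≤ aᵢ+bᵢ`,
and `min{a₁, b₁, c₁, a₁+b₁-c₁} ≥ 3`, if `f(a₁,b₁,c₁) = λ·f(a₂,b₂,c₂)` for a nonzero
`λ ∈ F_p`, then `a₁+b₁ = a₂+b₂` and, as subsets of `ℤ/pℤ`,
`{a₁, c₁, c₂-b₂-1} = {a₂, c₂, c₁-b₁-1}`. -/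
theorem stmt_14 (p : ℕ) (hp : p.Prime) (a₁ a₂ b₁ b₂ c₁ c₂ : ℕ)
    (ha₁ : a₁ ≤ p - 1) (hb₁ : b₁ ≤ p - 1) (hc₁ : c₁ ≤ a₁ + b₁)
    (ha₂ : a₂ ≤ p - 1) (hb₂ : b₂ ≤ p - 1) (hc₂ : c₂ ≤ a₂ + b₂)
    (hmin : 3 ≤ a₁ ∧ 3 ≤ b₁ ∧ 3 ≤ c₁ ∧ 3 ≤ a₁ + b₁ - c₁)
    (lam : ZMod p) (hlam : lam ≠ 0)
    (heq : fabc p a₁ b₁ c₁ = Polynomial.C lam * fabc p a₂ b₂ c₂) :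
    a₁ + b₁ = a₂ + b₂ ∧
    ({(a₁ : ZMod p), (c₁ : ZMod p), (((c₂ : ℤ) - (b₂ : ℤ) - 1 : ℤ) : ZMod p)} : Set (ZMod p))
      = {(a₂ : ZMod p), (c₂ : ZMod p), (((c₁ : ℤ) - (b₁ : ℤ) - 1 : ℤ) : ZMod p)} := by
  have := Fact.mk hp
  have hp₀ := hp.pos
  have hcoeff (i : ℕ) :
      (fabc p a₁ b₁ c₁).coeff i = lam * (fabc p a₂ b₂ c₂).coeff i := by
    rw [heq, Polynomial.coeff_C_mul]
  have hne₁ := fabc_coeff_ne_zero_iff (c := c₁) hp (by omega : a₁ < p) (by omega : b₁ < p)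
  have hne₂ := fabc_coeff_ne_zero_iff (c := c₂) hp (by omega : a₂ < p) (by omega : b₂ < p)
  have hsupp (i : ℕ) :
      (i ≤ a₁ ∧ i ≤ c₁ ∧ c₁ ≤ b₁ + i) ↔ (i ≤ a₂ ∧ i ≤ c₂ ∧ c₂ ≤ b₂ + i) := by
    rw [← hne₁, ← hne₂, hcoeff, Ne, mul_eq_zero, not_or]
    exact and_iff_right hlam
  have h2 : (2 : ZMod p) ≠ 0 := by
    intro h
    have := natCast_inj_of_lt (p := p) (m := 2) (n := 0) (by omega) (by omega) (by simpa using h)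
    omega
  have hstep (i : ℕ) (hi : i ≤ a₁ ∧ i ≤ c₁ ∧ c₁ ≤ b₁ + i)
      (hi' : i + 1 ≤ a₁ ∧ i + 1 ≤ c₁ ∧ c₁ ≤ b₁ + (i + 1)) :
      ((i : ZMod p) - a₁) * (i - c₁) * (i - (c₂ - b₂ - 1)) =
        (i - a₂) * (i - c₂) * (i - (c₁ - b₁ - 1)) := by
    have hj := (hsupp i).1 hi
    have hj' := (hsupp (i + 1)).1 hi'
    have e₁ := fabc_coeff_succ p hi.1 hi'.2.1 hi'.2.2
    have e₂ := fabc_coeff_succ p hj.1 hj'.2.1 hj'.2.2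
    rw [hcoeff, hcoeff] at e₁
    have hsucc : (i + 1 : ZMod p) ≠ 0 := by
      intro h
      have := natCast_inj_of_lt (p := p) (m := i + 1) (n := 0) (by omega) (by omega)
        (by simpa using h)
      omega
    have hi₀ := (hne₂ i).2 hj
    have hi₁ := (hne₂ (i + 1)).2 hj'
    generalize (fabc p a₂ b₂ c₂).coeff i = s at *
    generalize (fabc p a₂ b₂ c₂).coeff (i + 1) = t at *
    apply mul_left_cancel₀ (mul_ne_zero hlam hi₀)
    linear_combination (-(i + 1 + b₂ - c₂ : ZMod p)) * e₁ + lam * (i + 1 + b₁ - c₁) * e₂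
  obtain ⟨hsum, hcubic⟩ := monic_cubic_eq_of_consecutive h2
    (x := ((c₁ - b₁ : ℕ) : ZMod p)) (r := a₁) (s := c₁) (t := c₂ - b₂ - 1)
    (u := a₂) (v := c₂) (w := c₁ - b₁ - 1) (fun j hj => by
      have := hstep (c₁ - b₁ + j) (by omega) (by omega)
      rwa [Nat.cast_add] at this)
  constructor
  · have hmod : ((a₁ + b₁ : ℕ) : ZMod p) = (a₂ + b₂ : ℕ) := by
      push_cast
      linear_combination hsum
    have n₁ := add_ne_add_add_prime hp (by omega) (by omega) hc₁ hc₂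
      (fun i => (hsupp i).1) (by rw [← hcubic]; ring)
    have n₂ := add_ne_add_add_prime hp (by omega) (by omega) hc₂ hc₁
      (fun i => (hsupp i).2) (by rw [hcubic]; ring)
    obtain ⟨k, hk⟩ := (Nat.modEq_iff_dvd.1 ((ZMod.natCast_eq_natCast_iff _ _ _).1 hmod))
    push_cast at hk
    have hk₁ : k < 2 := by
      by_contra! h
      have : (p : ℤ) * 2 ≤ p * k := mul_le_mul_of_nonneg_left h (by omega)
      omega
    have hk₂ : -2 < k := by
      by_contra! h
      have : (p : ℤ) * k ≤ p * -2 := mul_le_mul_of_nonneg_left h (by omega)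
      omega
    interval_cases k <;> omega
  · ext y
    have := hcubic y
    have hiff : ((y - a₁) * (y - c₁) * (y - (c₂ - b₂ - 1)) = 0) ↔
        ((y - a₂) * (y - c₂) * (y - (c₁ - b₁ - 1)) = 0) := by rw [this]
    simpa [mul_eq_zero, sub_eq_zero (b := (_ : ZMod p)), or_assoc] using hiff
end
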